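/- (Muckenhoupt's maximal function theorem.) Let 1<p<∞ and let w be a weight on ℝ^d. The following are equivalent: (1) w ∈ A_p; (2) the Hardy–Littlewood maximal operator M is bounded from L^p(w) to weak-L^p(w), i.e. there is C with λ^p · w({Mf > λ}) ≤ C^p ‖f‖_{L^p(w)}^p for all f ∈ L^p(w) and λ > 0; (3) M is bounded from L^p(w) to L^p(w), i.e. there is C with ‖Mf‖_{L^p(w)} ≤ C‖f‖_{L^p(w)} for all f ∈ L^p(w). -/

import Mathlib

open MeasureTheory Set ENNReal

noncomputable section

/-- An axis-parallel cube in `ℝ^d` with corner `x` and side length `h`. -/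
def cube (d : ℕ) (x : Fin d → ℝ) (h : ℝ) : Set (Fin d → ℝ) :=
  Set.univ.pi fun i => Set.Ico (x i) (x i + h)

/-- The average of (the nonnegative part of) `w` over a set `I`, valued in `ℝ≥0∞`. -/
def lavg (d : ℕ) (w : (Fin d → ℝ) → ℝ) (I : Set (Fin d → ℝ)) : ℝ≥0∞ :=
  (volume I)⁻¹ * ∫⁻ y in I, ENNReal.ofReal (w y)

/-- The `A_p` characteristic of a weight `w` on `ℝ^d`:
the supremum over all cubes `I` of `(|I|⁻¹∫_I w)·(|I|⁻¹∫_I w^{-1/(p-1)})^{p-1}`. -/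
def ApChar (d : ℕ) (p : ℝ) (w : (Fin d → ℝ) → ℝ) : ℝ≥0∞ :=
  ⨆ (x : Fin d → ℝ) (h : Set.Ioi (0:ℝ)),
    lavg d w (cube d x h) *
      (lavg d (fun y => w y ^ (-1 / (p - 1))) (cube d x h)) ^ (p - 1)

/-- A weight on `ℝ^d`: a measurable, locally integrable, a.e. positive function. -/
def IsWeight (d : ℕ) (w : (Fin d → ℝ) → ℝ) : Prop :=
  Measurable w ∧ LocallyIntegrable w volume ∧ ∀ᵐ x : Fin d → ℝ, 0 < w x

/-- The Hardy–Littlewood maximal function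
`Mf(x) := sup_{t>0} (2t)^{−d} ∫_{[−t,t]^d} |f(x−u)| du`, valued in `ℝ≥0∞`. -/
def maximalFn (d : ℕ) (f : (Fin d → ℝ) → ℝ) (x : Fin d → ℝ) : ℝ≥0∞ :=
  ⨆ t : Set.Ioi (0:ℝ),
    (ENNReal.ofReal ((2 * (t:ℝ)) ^ d))⁻¹ *
      ∫⁻ u in Set.univ.pi fun _ : Fin d => Set.Icc (-(t:ℝ)) (t:ℝ), (‖f (x - u)‖₊ : ℝ≥0∞)


/-- The centered maximal function of `g` with respect to `μ`, over balls of rational radius. -/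
def centeredMaximal {α : Type*} [PseudoMetricSpace α] [MeasurableSpace α] (μ : Measure α)
    (g : α → ℝ≥0∞) (x : α) : ℝ≥0∞ :=
  ⨆ q : {q : ℚ // 0 < q}, (μ (Metric.closedBall x (q : ℚ)))⁻¹ *
    ∫⁻ y in Metric.closedBall x (q : ℚ), g y ∂μ

theorem lintegral_Ioi_rpow_indicator_lt {s : ℝ} (hs : 0 < s) (a : ℝ≥0∞) :
    ∫⁻ t in Ioi (0 : ℝ), ENNReal.ofReal (s * t ^ (s - 1)) *
      {t : ℝ | ENNReal.ofReal t < a}.indicator 1 t = a ^ s := by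
  have key : ∀ b : ℝ, 0 ≤ b → ∫⁻ t in Ioo (0 : ℝ) b, ENNReal.ofReal (s * t ^ (s - 1)) =
      ENNReal.ofReal b ^ s := by
    intro b hb
    have hi : IntervalIntegrable (fun t : ℝ => s * t ^ (s - 1)) volume 0 b :=
      (intervalIntegral.intervalIntegrable_rpow' (by linarith)).const_mul s
    rw [setLIntegral_congr Ioo_ae_eq_Ioc, ← ofReal_integral_eq_lintegral_ofReal,
      ← intervalIntegral.integral_of_le hb, intervalIntegral.integral_const_mul,
      integral_rpow (Or.inl (by linarith)), ENNReal.ofReal_rpow_of_nonneg hb hs.le]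
    · congr 1
      rw [sub_add_cancel, Real.zero_rpow hs.ne']
      field_simp
      ring
    · exact (intervalIntegrable_iff_integrableOn_Ioc_of_le hb).1 hi
    · filter_upwards [ae_restrict_mem measurableSet_Ioc] with t ht
      exact mul_nonneg hs.le (Real.rpow_nonneg ht.1.le _)
  have key' : ∀ b : ℝ, 0 ≤ b → ∫⁻ t in Ioi (0 : ℝ), ENNReal.ofReal (s * t ^ (s - 1)) *
      (Iio b).indicator 1 t = ENNReal.ofReal b ^ s := by
    intro b hb
    rw [← key b hb, ← Ioi_inter_Iio, inter_comm, ← Measure.restrict_restrict measurableSet_Iio,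
      ← lintegral_indicator measurableSet_Iio]
    refine lintegral_congr fun t => ?_
    by_cases h : t ∈ Iio b <;> simp [h]
  induction a with
  | top =>
    rw [ENNReal.top_rpow_of_pos hs]
    refine ENNReal.eq_top_of_forall_nnreal_le fun r => ?_
    have h := key' ((r : ℝ) ^ s⁻¹) (by positivity)
    rw [ENNReal.ofReal_rpow_of_nonneg (by positivity) hs.le, ← Real.rpow_mul (by positivity),
      inv_mul_cancel₀ hs.ne', Real.rpow_one, ENNReal.ofReal_coe_nnreal] at h
    rw [← h]
    gcongr
    intro t _
    simp
  | coe r =>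
    rw [← ENNReal.ofReal_coe_nnreal, ← key' r r.2, ENNReal.ofReal_coe_nnreal]
    refine setLIntegral_congr_fun measurableSet_Ioi fun t ht => ?_
    have : (t ∈ {t : ℝ | ENNReal.ofReal t < r}) ↔ t ∈ Iio (r : ℝ) := by
      rw [mem_ofPred_eq, ← ENNReal.ofReal_coe_nnreal,
        ENNReal.ofReal_lt_ofReal_iff_of_nonneg (le_of_lt ht), mem_Iio]
    by_cases h : t ∈ Iio (r : ℝ)
    · simp only [indicator_of_mem h, indicator_of_mem (this.2 h)]
    · simp only [indicator_of_notMem h, indicator_of_notMem (mt this.1 h)]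

theorem centeredMaximal_le_add {α : Type*} [PseudoMetricSpace α] [MeasurableSpace α]
    (μ : Measure α) (g : α → ℝ≥0∞) (l : ℝ≥0∞) (x : α) :
    centeredMaximal μ g x ≤ centeredMaximal μ ({y | l < g y}.indicator g) x + l := by
  refine iSup_le fun q => ?_
  have h : ∀ y, g y ≤ {y | l < g y}.indicator g y + l := by
    intro y
    by_cases hy : l < g y
    · simp [indicator, hy]
    · exact (not_lt.1 hy).trans le_add_self
  set B := Metric.closedBall x ((q : ℚ) : ℝ)
  calc (μ B)⁻¹ * ∫⁻ y in B, g y ∂μ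
      ≤ (μ B)⁻¹ * ∫⁻ y in B, ({y | l < g y}.indicator g y + l) ∂μ := by
        gcongr with y; exact h y
    _ = (μ B)⁻¹ * ∫⁻ y in B, {y | l < g y}.indicator g y ∂μ + (μ B)⁻¹ * μ B * l := by
        rw [lintegral_add_right _ measurable_const, mul_add, setLIntegral_const, mul_comm l,
          mul_assoc]
    _ ≤ _ := by
        gcongr
        · exact le_iSup (fun q : {q : ℚ // 0 < q} => (μ (Metric.closedBall x (q : ℚ)))⁻¹ *
            ∫⁻ y in Metric.closedBall x (q : ℚ), {y | l < g y}.indicator g y ∂μ) q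
        · exact mul_le_of_le_one_left' (ENNReal.inv_mul_le_one _)

section CenteredMaximal

variable {α : Type*} [MetricSpace α] [SecondCountableTopology α] [MeasurableSpace α]
  [OpensMeasurableSpace α]

theorem measurable_setLIntegral_closedBall (μ : Measure α) [SFinite μ] {g : α → ℝ≥0∞}
    (hg : Measurable g) (r : ℝ) :
    Measurable fun x => ∫⁻ y in Metric.closedBall x r, g y ∂μ := by
  have hs : MeasurableSet {z : α × α | dist z.2 z.1 ≤ r} :=
    measurableSet_le (measurable_snd.dist measurable_fst) measurable_const
  have h : Measurable fun x => ∫⁻ y,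
      {z : α × α | dist z.2 z.1 ≤ r}.indicator (fun z => g z.2) (x, y) ∂μ :=
    ((hg.comp measurable_snd).indicator hs).lintegral_prod_right'
  convert h using 2 with x
  rw [← lintegral_indicator measurableSet_closedBall]
  rfl

theorem measurable_centeredMaximal (μ : Measure α) [SFinite μ] {g : α → ℝ≥0∞}
    (hg : Measurable g) : Measurable (centeredMaximal μ g) := by
  refine Measurable.iSup fun q => ?_
  refine Measurable.mul (Measurable.inv ?_) (measurable_setLIntegral_closedBall μ hg _)
  simpa using measurable_setLIntegral_closedBall μ (measurable_const (a := (1 : ℝ≥0∞))) (q : ℚ)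

variable (α) in
theorem exists_centeredMaximal_weak_type [HasBesicovitchCovering α] :
    ∃ N : ℕ, ∀ (μ : Measure α) (g : α → ℝ≥0∞) (l : ℝ≥0∞),
      l * μ {x | l < centeredMaximal μ g x} ≤ N * ∫⁻ x, g x ∂μ := by
  obtain ⟨N, τ, hτ, hN⟩ := HasBesicovitchCovering.no_satelliteConfig (α := α)
  refine ⟨N, fun μ g l => ?_⟩
  let E : ℕ → Set α := fun n => {x | ∃ q : ℚ, 0 < q ∧ q ≤ n ∧
    l * μ (Metric.closedBall x q) ≤ ∫⁻ y in Metric.closedBall x q, g y ∂μ}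
  have hE : ∀ n, l * μ (E n) ≤ N * ∫⁻ x, g x ∂μ := by
    intro n
    choose! r hr0 hrn hr using fun x (hx : x ∈ E n) => hx
    let P : Besicovitch.BallPackage (E n) α :=
      { c := fun x => x
        r := fun x => r x
        rpos := fun x => by exact_mod_cast hr0 x x.2
        r_bound := n
        r_le := fun x => by exact_mod_cast hrn x x.2 }
    obtain ⟨s, hs, hcov⟩ := Besicovitch.exist_disjoint_covering_families hτ hN P
    have hcount : ∀ i, (s i).Countable := fun i =>
      (hs i).countable_of_nonempty_interior fun j _ =>
        ⟨P.c j, Metric.ball_subset_interior_closedBall (Metric.mem_ball_self (P.rpos j))⟩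
    have hsub : E n ⊆ ⋃ i : Fin N, ⋃ j ∈ s i, Metric.closedBall (P.c j) (P.r j) := by
      intro x hx
      have := hcov ⟨⟨x, hx⟩, rfl⟩
      simp only [mem_iUnion] at this ⊢
      obtain ⟨i, j, hj, h⟩ := this
      exact ⟨i, j, hj, Metric.ball_subset_closedBall h⟩
    calc l * μ (E n) ≤ l * ∑ i : Fin N, ∑' j : s i, μ (Metric.closedBall (P.c j) (P.r j)) := by
          gcongr
          refine (measure_mono hsub).trans ((measure_iUnion_fintype_le _ _).trans ?_)
          exact Finset.sum_le_sum fun i _ => measure_biUnion_le _ (hcount i) _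
      _ = ∑ i : Fin N, ∑' j : s i, l * μ (Metric.closedBall (P.c j) (P.r j)) := by
          simp_rw [Finset.mul_sum, ENNReal.tsum_mul_left]
      _ ≤ ∑ i : Fin N, ∑' j : s i, ∫⁻ y in Metric.closedBall (P.c j) (P.r j), g y ∂μ := by
          gcongr with i _ j
          exact hr _ (j : E n).2
      _ ≤ ∑ i : Fin N, ∫⁻ x, g x ∂μ := by
          gcongr with i _
          rw [← lintegral_biUnion (hcount i) (fun _ _ => Metric.isClosed_closedBall.measurableSet)
            (hs i)]
          exact setLIntegral_le_lintegral _ _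
      _ = N * ∫⁻ x, g x ∂μ := by simp
  have hmono : Monotone E := by
    rintro m n hmn x ⟨q, h0, hq, h⟩
    exact ⟨q, h0, hq.trans (by exact_mod_cast hmn), h⟩
  have hsub : {x | l < centeredMaximal μ g x} ⊆ ⋃ n, E n := by
    intro x hx
    have hx' : l < centeredMaximal μ g x := hx
    obtain ⟨q, hq⟩ := lt_iSup_iff.1 hx'
    obtain ⟨n, hn⟩ := exists_nat_ge (q : ℚ)
    refine mem_iUnion.2 ⟨n, q, q.2, hn, ?_⟩
    rw [mul_comm]
    refine ENNReal.mul_le_of_le_div' (hq.le.trans_eq ?_)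
    rw [ENNReal.div_eq_inv_mul]
  calc l * μ {x | l < centeredMaximal μ g x} ≤ l * μ (⋃ n, E n) := by gcongr
    _ = ⨆ n, l * μ (E n) := by rw [hmono.measure_iUnion, ENNReal.mul_iSup]
    _ ≤ _ := iSup_le hE

variable (α) in
theorem exists_lintegral_centeredMaximal_rpow_le [HasBesicovitchCovering α] {q : ℝ} (hq : 1 < q) :
    ∃ C : ℝ≥0∞, C ≠ ⊤ ∧ ∀ (μ : Measure α) [SFinite μ] (g : α → ℝ≥0∞), Measurable g →
      ∫⁻ x, centeredMaximal μ g x ^ q ∂μ ≤ C * ∫⁻ x, g x ^ q ∂μ := by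
  obtain ⟨N, hN⟩ := exists_centeredMaximal_weak_type α
  refine ⟨N * (ENNReal.ofReal (2 * q / (q - 1)) * 2 ^ (q - 1)), by finiteness, ?_⟩
  intro μ _ g hg
  have hq0 : 0 < q := by linarith
  have hM := measurable_centeredMaximal μ hg
  have hweak : ∀ t : ℝ, 0 < t → ENNReal.ofReal (q * t ^ (q - 1)) *
      μ {x | ENNReal.ofReal t < centeredMaximal μ g x} ≤
      N * ∫⁻ x, ENNReal.ofReal (2 * q * t ^ (q - 2)) *
        ({x | ENNReal.ofReal t < 2 * g x}.indicator g x) ∂μ := by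
    intro t ht
    have hset : {x | ENNReal.ofReal (t / 2) < g x} = {x | ENNReal.ofReal t < 2 * g x} := by
      ext x
      simp only [mem_ofPred_eq]
      rw [ENNReal.ofReal_div_of_pos two_pos, ENNReal.ofReal_ofNat,
        ENNReal.div_lt_iff (by simp) (by simp), mul_comm]
    have hm : MeasurableSet {x | ENNReal.ofReal t < 2 * g x} :=
      measurableSet_lt measurable_const (hg.const_mul 2)
    have h1 : μ {x | ENNReal.ofReal t < centeredMaximal μ g x} ≤
        μ {x | ENNReal.ofReal (t / 2) <
          centeredMaximal μ ({x | ENNReal.ofReal t < 2 * g x}.indicator g) x} := by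
      refine measure_mono fun x hx => ?_
      have h := centeredMaximal_le_add μ g (ENNReal.ofReal (t / 2)) x
      rw [hset] at h
      simp only [mem_ofPred_eq] at hx ⊢
      by_contra! hc
      refine absurd (hx.trans_le (h.trans (add_le_add_left hc _))) ?_
      rw [← ENNReal.ofReal_add (by positivity) (by positivity), add_halves]
      exact lt_irrefl _
    have h2 : ENNReal.ofReal (q * t ^ (q - 1)) =
        ENNReal.ofReal (2 * q * t ^ (q - 2)) * ENNReal.ofReal (t / 2) := by
      rw [← ENNReal.ofReal_mul (by positivity)]
      congr 1
      rw [show q - 1 = (q - 2) + 1 by ring, Real.rpow_add_one ht.ne']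
      ring
    rw [lintegral_const_mul _ (hg.indicator hm), h2, mul_assoc, mul_left_comm (N : ℝ≥0∞)]
    refine mul_le_mul_right ?_ _
    exact (mul_le_mul_right h1 _).trans (hN μ _ _)
  have hmeas2 : MeasurableSet {z : α × ℝ | ENNReal.ofReal z.2 < centeredMaximal μ g z.1} :=
    measurableSet_lt (ENNReal.measurable_ofReal.comp measurable_snd) (hM.comp measurable_fst)
  have hmeas3 : MeasurableSet {z : ℝ × α | ENNReal.ofReal z.1 < 2 * g z.2} :=
    measurableSet_lt (ENNReal.measurable_ofReal.comp measurable_fst)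
      ((hg.comp measurable_snd).const_mul 2)
  calc ∫⁻ x, centeredMaximal μ g x ^ q ∂μ
      = ∫⁻ x, (∫⁻ t in Ioi (0 : ℝ), ENNReal.ofReal (q * t ^ (q - 1)) *
        {t : ℝ | ENNReal.ofReal t < centeredMaximal μ g x}.indicator 1 t) ∂μ := by
        simp_rw [lintegral_Ioi_rpow_indicator_lt hq0]
    _ = ∫⁻ t in Ioi (0 : ℝ), (∫⁻ x, ENNReal.ofReal (q * t ^ (q - 1)) *
        {t : ℝ | ENNReal.ofReal t < centeredMaximal μ g x}.indicator 1 t ∂μ) := by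
        refine lintegral_lintegral_swap (Measurable.aemeasurable ?_)
        exact Measurable.mul (by fun_prop)
          ((measurable_const (a := (1 : ℝ≥0∞))).indicator hmeas2)
    _ = ∫⁻ t in Ioi (0 : ℝ), ENNReal.ofReal (q * t ^ (q - 1)) *
        μ {x | ENNReal.ofReal t < centeredMaximal μ g x} := by
        refine lintegral_congr fun t => ?_
        have hm : MeasurableSet {x | ENNReal.ofReal t < centeredMaximal μ g x} :=
          measurableSet_lt measurable_const hM
        rw [← lintegral_indicator_one hm, ← lintegral_const_mul _ (measurable_one.indicator hm)]
        rfl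
    _ ≤ ∫⁻ t in Ioi (0 : ℝ), N * ∫⁻ x, ENNReal.ofReal (2 * q * t ^ (q - 2)) *
        ({x | ENNReal.ofReal t < 2 * g x}.indicator g x) ∂μ :=
        setLIntegral_mono' measurableSet_Ioi hweak
    _ = N * ∫⁻ t in Ioi (0 : ℝ), ∫⁻ x, ENNReal.ofReal (2 * q * t ^ (q - 2)) *
        ({x | ENNReal.ofReal t < 2 * g x}.indicator g x) ∂μ :=
        lintegral_const_mul' _ _ (by simp)
    _ = N * ∫⁻ x, (∫⁻ t in Ioi (0 : ℝ), ENNReal.ofReal (2 * q * t ^ (q - 2)) *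
        ({x | ENNReal.ofReal t < 2 * g x}.indicator g x)) ∂μ := by
        congr 1
        refine lintegral_lintegral_swap (Measurable.aemeasurable ?_)
        exact Measurable.mul (by fun_prop) ((hg.comp measurable_snd).indicator hmeas3)
    _ = N * ∫⁻ x, (ENNReal.ofReal (2 * q / (q - 1)) * 2 ^ (q - 1)) * g x ^ q ∂μ := by
        congr 1
        refine lintegral_congr fun x => ?_
        have hq1 : 0 < q - 1 := by linarith
        have : ∀ t : ℝ, ENNReal.ofReal (2 * q * t ^ (q - 2)) *
            ({x | ENNReal.ofReal t < 2 * g x}.indicator g x) =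
            (ENNReal.ofReal (2 * q / (q - 1)) * g x) * (ENNReal.ofReal ((q - 1) * t ^ (q - 1 - 1)) *
              {t : ℝ | ENNReal.ofReal t < 2 * g x}.indicator 1 t) := by
          intro t
          have h1 : ENNReal.ofReal (2 * q * t ^ (q - 2)) = ENNReal.ofReal (2 * q / (q - 1)) *
              ENNReal.ofReal ((q - 1) * t ^ (q - 1 - 1)) := by
            rw [← ENNReal.ofReal_mul (by positivity)]
            congr 1
            rw [show q - 1 - 1 = q - 2 by ring]
            field_simp
          by_cases ht : ENNReal.ofReal t < 2 * g x
          · simp only [indicator, mem_ofPred_eq, ht, if_true, h1, Pi.one_apply]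
            ring
          · simp [indicator, ht]
        simp_rw [this]
        rw [lintegral_const_mul _ (by
            exact Measurable.mul (by fun_prop) (measurable_one.indicator
              (measurableSet_lt ENNReal.measurable_ofReal measurable_const))),
          lintegral_Ioi_rpow_indicator_lt hq1, ENNReal.mul_rpow_of_nonneg _ _ hq1.le]
        have : g x ^ q = g x * g x ^ (q - 1) := by
          conv_lhs => rw [show q = 1 + (q - 1) by ring,
            ENNReal.rpow_add_of_nonneg _ _ zero_le_one hq1.le, ENNReal.rpow_one]
        rw [this]
        ring
    _ = _ := by
        rw [lintegral_const_mul _ (hg.pow_const q), ← mul_assoc]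

end CenteredMaximal

theorem ENNReal.le_mul_mul_of_mul_rpow_le {a b A V I : ℝ≥0∞} {r : ℝ} (hr : 0 < r)
    (ha0 : a ≠ 0) (ha : a ≠ ⊤) (hA0 : A ≠ 0) (hA : A ≠ ⊤) (hV0 : V ≠ 0) (hV : V ≠ ⊤)
    (h : a * b ^ r ≤ A * V ^ (r + 1)) :
    (V⁻¹ * I) ^ r ≤ A * (a⁻¹ * ((b⁻¹ * I) ^ r * V)) := by
  have h1 : A⁻¹ * (V⁻¹ * (V⁻¹) ^ r) ≤ a⁻¹ * (b⁻¹) ^ r := by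
    have h2 := ENNReal.inv_le_inv.2 h
    rw [ENNReal.mul_inv (Or.inl ha0) (Or.inl ha), ENNReal.mul_inv (Or.inl hA0) (Or.inl hA),
      ← ENNReal.inv_rpow, ← ENNReal.inv_rpow,
      ENNReal.rpow_add _ _ (by simpa using hV) (by simpa using hV0), ENNReal.rpow_one] at h2
    rwa [mul_comm (V⁻¹)]
  calc (V⁻¹ * I) ^ r = (A * A⁻¹) * (V * V⁻¹) * (V⁻¹ * I) ^ r := by
        rw [ENNReal.mul_inv_cancel hA0 hA, ENNReal.mul_inv_cancel hV0 hV, one_mul, one_mul]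
    _ = A * V * (A⁻¹ * (V⁻¹ * (V⁻¹) ^ r)) * I ^ r := by
        rw [ENNReal.mul_rpow_of_nonneg _ _ hr.le]; ring
    _ ≤ A * V * (a⁻¹ * (b⁻¹) ^ r) * I ^ r := by gcongr
    _ = _ := by rw [ENNReal.mul_rpow_of_nonneg _ _ hr.le]; ring

theorem setLIntegral_withDensity_inv_mul {α : Type*} [MeasurableSpace α] (μ : Measure α)
    {u g : α → ℝ≥0∞} (hu : Measurable u) (hu0 : ∀ᵐ x ∂μ, u x ≠ 0 ∧ u x ≠ ⊤) (hg : Measurable g)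
    {s : Set α} (hs : MeasurableSet s) :
    ∫⁻ x in s, (u x)⁻¹ * g x ∂(μ.withDensity u) = ∫⁻ x in s, g x ∂μ := by
  have hm : Measurable fun x => (u x)⁻¹ * g x := hu.inv.mul hg
  rw [setLIntegral_withDensity_eq_setLIntegral_mul _ hu hm hs]
  refine lintegral_congr_ae (ae_restrict_of_ae ?_)
  filter_upwards [hu0] with z hz
  simp only [Pi.mul_apply]
  rw [← mul_assoc, ENNReal.mul_inv_cancel hz.1 hz.2, one_mul]

section Weight

variable {d : ℕ}

theorem volume_closedBall_three_mul (x : Fin d → ℝ) {r : ℝ} (hr : 0 ≤ r) :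
    volume (Metric.closedBall x (3 * r)) = 3 ^ d * volume (Metric.closedBall x r) := by
  rw [Real.volume_pi_closedBall _ hr, Real.volume_pi_closedBall _ (by positivity),
    show 2 * (3 * r) = 3 * (2 * r) by ring, mul_pow, ENNReal.ofReal_mul (by positivity),
    Fintype.card_fin, ENNReal.ofReal_pow (by norm_num), ENNReal.ofReal_ofNat]

/-- Lerner's pointwise bound of the unweighted centered maximal function by an iterate of
weighted ones, under an `A_p` condition for the weight `v`. -/
theorem centeredMaximal_volume_le {p : ℝ} (hp : 1 < p) {v : (Fin d → ℝ) → ℝ≥0∞}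
    (hv : Measurable v) (hv0 : ∀ᵐ x, v x ≠ 0 ∧ v x ≠ ⊤)
    (hvB : ∀ x r, ∫⁻ y in Metric.closedBall x r, v y ≠ ⊤) {A : ℝ≥0∞} (hA0 : A ≠ 0) (hA : A ≠ ⊤)
    (h : ∀ x r, 0 < r → (∫⁻ y in Metric.closedBall x r, v y) *
      (∫⁻ y in Metric.closedBall x r, v y ^ (-(p - 1)⁻¹)) ^ (p - 1) ≤
        A * volume (Metric.closedBall x r) ^ p)
    {f : (Fin d → ℝ) → ℝ≥0∞} (hf : Measurable f) (x : Fin d → ℝ) :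
    centeredMaximal volume f x ≤ (A * (3 ^ d) ^ p * centeredMaximal (volume.withDensity v)
      (fun y => (v y)⁻¹ * centeredMaximal (volume.withDensity fun z => v z ^ (-(p - 1)⁻¹))
        (fun z => (v z ^ (-(p - 1)⁻¹))⁻¹ * f z) y ^ (p - 1)) x) ^ (p - 1)⁻¹ := by
  have hp1 : 0 < p - 1 := by linarith
  set s : (Fin d → ℝ) → ℝ≥0∞ := fun z => v z ^ (-(p - 1)⁻¹) with hs_def
  have hs : Measurable s := hv.pow_const _
  have hs0 : ∀ᵐ x, s x ≠ 0 ∧ s x ≠ ⊤ := by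
    filter_upwards [hv0] with x hx
    exact ⟨(ENNReal.rpow_pos (pos_iff_ne_zero.2 hx.1) hx.2).ne',
      ENNReal.rpow_ne_top_of_ne_zero hx.1 hx.2⟩
  set H := centeredMaximal (volume.withDensity s) (fun z => (s z)⁻¹ * f z) with hH
  have hHm : Measurable H := measurable_centeredMaximal _ (hs.inv.mul hf)
  refine iSup_le fun q => ?_
  have hq : (0 : ℝ) < (q : ℚ) := by exact_mod_cast q.2
  rw [ENNReal.le_rpow_inv_iff hp1]
  set B := Metric.closedBall x ((q : ℚ) : ℝ) with hB
  set T := Metric.closedBall x (3 * ((q : ℚ) : ℝ)) with hT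
  have hBm : MeasurableSet B := measurableSet_closedBall
  have hBT : B ⊆ T := Metric.closedBall_subset_closedBall (by linarith)
  have hV : volume T = 3 ^ d * volume B := volume_closedBall_three_mul x hq.le
  have hB0 : volume B ≠ 0 := (Metric.measure_closedBall_pos volume x hq).ne'
  have hBtop : volume B ≠ ⊤ := measure_closedBall_lt_top.ne
  have hlow : ∀ y ∈ B, (∫⁻ z in T, s z)⁻¹ * ∫⁻ z in B, f z ≤ H y := by
    intro y hy
    have hyx : dist y x ≤ (q : ℚ) := hy
    have hsub1 : B ⊆ Metric.closedBall y (((2 * (q : ℚ) : ℚ)) : ℝ) := by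
      refine Metric.closedBall_subset_closedBall' ?_
      rw [dist_comm]; push_cast; linarith
    have hsub2 : Metric.closedBall y (((2 * (q : ℚ) : ℚ)) : ℝ) ⊆ T := by
      refine Metric.closedBall_subset_closedBall' ?_
      push_cast; linarith
    refine le_trans ?_ (le_iSup _ (⟨2 * (q : ℚ), by have := q.2; positivity⟩ : {q : ℚ // 0 < q}))
    rw [← setLIntegral_withDensity_inv_mul _ hs hs0 hf hBm]
    refine mul_le_mul' (ENNReal.inv_le_inv.2 ?_) (lintegral_mono_set hsub1)
    rw [withDensity_apply _ measurableSet_closedBall]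
    exact lintegral_mono_set hsub2
  have hup : ((∫⁻ z in T, s z)⁻¹ * ∫⁻ z in B, f z) ^ (p - 1) * volume B ≤
      ∫⁻ y in B, (v y)⁻¹ * H y ^ (p - 1) ∂(volume.withDensity v) := by
    rw [setLIntegral_withDensity_inv_mul _ hv hv0 (hHm.pow_const _) hBm, ← setLIntegral_const]
    exact setLIntegral_mono' hBm fun y hy => by gcongr; exact hlow y hy
  have hvB0 : ∫⁻ y in B, v y ≠ 0 := by
    refine ((setLIntegral_pos_iff hv).2 ?_).ne'
    have : B =ᵐ[volume] (Function.support v ∩ B : Set _) := by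
      filter_upwards [hv0] with z hz
      exact propext ⟨fun h => ⟨hz.1, h⟩, fun h => h.2⟩
    rw [← measure_congr this]
    exact pos_iff_ne_zero.2 hB0
  have hAT : (∫⁻ y in B, v y) * (∫⁻ y in T, s y) ^ (p - 1) ≤
      A * (3 ^ d) ^ p * volume B ^ (p - 1 + 1) := by
    calc (∫⁻ y in B, v y) * (∫⁻ y in T, s y) ^ (p - 1)
        ≤ (∫⁻ y in T, v y) * (∫⁻ y in T, s y) ^ (p - 1) := by
          gcongr
      _ ≤ A * volume T ^ p := h x _ (by positivity)
      _ = _ := by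
          rw [hV, ENNReal.mul_rpow_of_nonneg _ _ (by linarith), sub_add_cancel, mul_assoc]
  refine (ENNReal.le_mul_mul_of_mul_rpow_le hp1 hvB0 (hvB _ _) ?_ ?_ hB0 hBtop hAT).trans ?_
  · refine mul_ne_zero hA0 (ENNReal.rpow_pos ?_ (by simp)).ne'
    positivity
  · exact ENNReal.mul_ne_top hA (ENNReal.rpow_ne_top_of_nonneg (by linarith) (by simp))
  refine mul_le_mul_right ?_ _
  refine le_trans ?_ (le_iSup _ q)
  rw [withDensity_apply _ measurableSet_closedBall]
  exact mul_le_mul_right hup _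

theorem exists_lintegral_centeredMaximal_volume_rpow_le {p : ℝ} (hp : 1 < p)
    {v : (Fin d → ℝ) → ℝ≥0∞}
    (hv : Measurable v) (hv0 : ∀ᵐ x, v x ≠ 0 ∧ v x ≠ ⊤)
    (hvB : ∀ x r, ∫⁻ y in Metric.closedBall x r, v y ≠ ⊤) {A : ℝ≥0∞} (hA0 : A ≠ 0) (hA : A ≠ ⊤)
    (h : ∀ x r, 0 < r → (∫⁻ y in Metric.closedBall x r, v y) *
      (∫⁻ y in Metric.closedBall x r, v y ^ (-(p - 1)⁻¹)) ^ (p - 1) ≤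
        A * volume (Metric.closedBall x r) ^ p) :
    ∃ D : ℝ≥0∞, D ≠ ⊤ ∧ ∀ f : (Fin d → ℝ) → ℝ≥0∞, Measurable f →
      ∫⁻ x, centeredMaximal volume f x ^ p * v x ≤ D * ∫⁻ x, f x ^ p * v x := by
  have hp1 : 0 < p - 1 := by linarith
  have hp0 : 0 < p := by linarith
  have hq : 1 < (p - 1)⁻¹ * p := by
    rw [inv_mul_eq_div, lt_div_iff₀ hp1]; linarith
  obtain ⟨C₁, hC₁, h₁⟩ := exists_lintegral_centeredMaximal_rpow_le (Fin d → ℝ) hq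
  obtain ⟨C₂, hC₂, h₂⟩ := exists_lintegral_centeredMaximal_rpow_le (Fin d → ℝ) hp
  set K : ℝ≥0∞ := A * (3 ^ d) ^ p with hK
  have hKtop : K ≠ ⊤ :=
    ENNReal.mul_ne_top hA (ENNReal.rpow_ne_top_of_nonneg (by linarith) (by simp))
  refine ⟨K ^ ((p - 1)⁻¹ * p) * (C₁ * C₂), ENNReal.mul_ne_top
    (ENNReal.rpow_ne_top_of_nonneg (by positivity) hKtop) (ENNReal.mul_ne_top hC₁ hC₂), ?_⟩
  intro f hf
  set s : (Fin d → ℝ) → ℝ≥0∞ := fun z => v z ^ (-(p - 1)⁻¹) with hs_def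
  have hs : Measurable s := hv.pow_const _
  set F : (Fin d → ℝ) → ℝ≥0∞ := fun z => (s z)⁻¹ * f z with hF
  have hFm : Measurable F := hs.inv.mul hf
  set H := centeredMaximal (volume.withDensity s) F with hH
  have hHm : Measurable H := measurable_centeredMaximal _ hFm
  set G : (Fin d → ℝ) → ℝ≥0∞ := fun y => (v y)⁻¹ * H y ^ (p - 1) with hG
  have hGm : Measurable G := hv.inv.mul (hHm.pow_const _)
  have hMm : Measurable (centeredMaximal (volume.withDensity v) G) :=
    measurable_centeredMaximal _ hGm
  have hGH : ∫⁻ x, G x ^ ((p - 1)⁻¹ * p) ∂(volume.withDensity v) =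
      ∫⁻ x, H x ^ p ∂(volume.withDensity s) := by
    rw [lintegral_withDensity_eq_lintegral_mul _ hv (hGm.pow_const _),
      lintegral_withDensity_eq_lintegral_mul _ hs (hHm.pow_const _)]
    refine lintegral_congr_ae ?_
    filter_upwards [hv0] with x hx
    simp only [Pi.mul_apply, hG, hs_def]
    rw [ENNReal.mul_rpow_of_nonneg _ _ (by positivity), ← mul_assoc, ← ENNReal.rpow_mul,
      ← ENNReal.rpow_neg_one, ← ENNReal.rpow_mul]
    nth_rw 1 [← ENNReal.rpow_one (v x)]
    rw [← ENNReal.rpow_add _ _ hx.1 hx.2]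
    congr 2
    · field_simp; ring
    · field_simp
  have hFf : ∫⁻ x, F x ^ p ∂(volume.withDensity s) = ∫⁻ x, f x ^ p * v x := by
    rw [lintegral_withDensity_eq_lintegral_mul _ hs (hFm.pow_const _)]
    refine lintegral_congr_ae ?_
    filter_upwards [hv0] with x hx
    simp only [Pi.mul_apply, hF, hs_def]
    rw [ENNReal.mul_rpow_of_nonneg _ _ (by positivity), ← mul_assoc, mul_comm (f x ^ p),
      ← ENNReal.rpow_neg, ← ENNReal.rpow_mul, ← ENNReal.rpow_add _ _ hx.1 hx.2]
    nth_rw 2 [← ENNReal.rpow_one (v x)]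
    congr 2
    field_simp
    ring
  calc ∫⁻ x, centeredMaximal volume f x ^ p * v x
      ≤ ∫⁻ x, K ^ ((p - 1)⁻¹ * p) *
        (v x * centeredMaximal (volume.withDensity v) G x ^ ((p - 1)⁻¹ * p)) := by
        refine lintegral_mono fun x => ?_
        calc centeredMaximal volume f x ^ p * v x
            ≤ ((K * centeredMaximal (volume.withDensity v) G x) ^ (p - 1)⁻¹) ^ p * v x := by
              gcongr
              exact centeredMaximal_volume_le hp hv hv0 hvB hA0 hA h hf x
          _ = _ := by
              rw [← ENNReal.rpow_mul, ENNReal.mul_rpow_of_nonneg _ _ (by positivity)]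
              ring
    _ = K ^ ((p - 1)⁻¹ * p) *
        ∫⁻ x, centeredMaximal (volume.withDensity v) G x ^ ((p - 1)⁻¹ * p)
          ∂(volume.withDensity v) := by
        rw [lintegral_withDensity_eq_lintegral_mul _ hv (hMm.pow_const _),
          ← lintegral_const_mul _ (hv.mul (hMm.pow_const _))]
        rfl
    _ ≤ K ^ ((p - 1)⁻¹ * p) * (C₁ * (C₂ * ∫⁻ x, f x ^ p * v x)) := by
        rw [← hFf]
        gcongr
        refine (h₁ _ G hGm).trans ?_
        rw [hGH]
        gcongr
        exact h₂ _ F hFm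
    _ = _ := by ring

end Weight

theorem volume_cube (d : ℕ) (x : Fin d → ℝ) (h : ℝ) :
    volume (cube d x h) = ENNReal.ofReal h ^ d := by
  simp [cube, Real.volume_pi_Ico]

theorem measurableSet_cube (d : ℕ) (x : Fin d → ℝ) (h : ℝ) : MeasurableSet (cube d x h) :=
  MeasurableSet.univ_pi fun _ => measurableSet_Ico

theorem cube_subset_closedBall {d : ℕ} {x y : Fin d → ℝ} {h : ℝ} (hh : 0 ≤ h)
    (hy : y ∈ cube d x h) : cube d x h ⊆ Metric.closedBall y h := by
  intro z hz
  refine (dist_pi_le_iff hh).2 fun i => ?_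
  have h1 := hy i (mem_univ i)
  have h2 := hz i (mem_univ i)
  rw [Real.dist_eq, abs_le]
  constructor <;> linarith [h1.1, h1.2, h2.1, h2.2]

theorem closedBall_subset_cube {d : ℕ} (x : Fin d → ℝ) {r : ℝ} (hr : 0 < r) :
    Metric.closedBall x r ⊆ cube d (fun i => x i - r) (4 * r) := by
  intro z hz i _
  have h := (dist_pi_le_iff hr.le).1 hz i
  rw [Real.dist_eq, abs_le] at h
  constructor <;> linarith [h.1, h.2]

theorem maximalFn_eq_iSup_closedBall (d : ℕ) (f : (Fin d → ℝ) → ℝ) (x : Fin d → ℝ) :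
    maximalFn d f x = ⨆ t : Set.Ioi (0 : ℝ), (volume (Metric.closedBall x (t : ℝ)))⁻¹ *
      ∫⁻ y in Metric.closedBall x (t : ℝ), ‖f y‖ₑ := by
  refine iSup_congr fun t => ?_
  have ht : (0 : ℝ) ≤ t := le_of_lt t.2
  have hset : (Set.univ.pi fun _ : Fin d => Set.Icc (-(t : ℝ)) (t : ℝ)) =
      Metric.closedBall 0 (t : ℝ) := by
    rw [closedBall_pi _ ht]
    simp [Real.closedBall_eq_Icc]
  rw [Real.volume_pi_closedBall _ ht, Fintype.card_fin, hset,
    ← lintegral_indicator measurableSet_closedBall, ← lintegral_indicator measurableSet_closedBall,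
    ← lintegral_sub_left_eq_self ((Metric.closedBall x (t : ℝ)).indicator fun y => ‖f y‖ₑ) x]
  congr 1
  refine lintegral_congr fun u => ?_
  have : x - u ∈ Metric.closedBall x (t : ℝ) ↔ u ∈ Metric.closedBall 0 (t : ℝ) := by
    simp [dist_eq_norm]
  by_cases hu : u ∈ Metric.closedBall 0 (t : ℝ)
  · rw [indicator_of_mem hu, indicator_of_mem (this.2 hu)]; rfl
  · rw [indicator_of_notMem hu, indicator_of_notMem (mt this.1 hu)]

theorem maximalFn_le_centeredMaximal (d : ℕ) (f : (Fin d → ℝ) → ℝ) (x : Fin d → ℝ) :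
    maximalFn d f x ≤ 2 ^ d * centeredMaximal volume (fun y => ‖f y‖ₑ) x := by
  rw [maximalFn_eq_iSup_closedBall]
  refine iSup_le fun t => ?_
  have ht : (0 : ℝ) < t := t.2
  obtain ⟨q, hq1, hq2⟩ := exists_rat_btwn (show (t : ℝ) < 2 * t by linarith)
  have hq : 0 < q := by exact_mod_cast ht.trans hq1
  have hvol : volume (Metric.closedBall x (q : ℝ)) ≤
      2 ^ d * volume (Metric.closedBall x (t : ℝ)) := by
    rw [Real.volume_pi_closedBall _ ht.le, Real.volume_pi_closedBall _ (ht.trans hq1).le,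
      Fintype.card_fin, ← ENNReal.ofReal_ofNat, ← ENNReal.ofReal_pow (by norm_num),
      ← ENNReal.ofReal_mul (by positivity), ← mul_pow]
    gcongr
  have hinv : (volume (Metric.closedBall x (t : ℝ)))⁻¹ ≤
      2 ^ d * (volume (Metric.closedBall x (q : ℝ)))⁻¹ := by
    calc (volume (Metric.closedBall x (t : ℝ)))⁻¹
        = 2 ^ d * (2 ^ d * volume (Metric.closedBall x (t : ℝ)))⁻¹ := by
          rw [ENNReal.mul_inv (by simp) (by simp), ← mul_assoc,
            ENNReal.mul_inv_cancel (by simp) (by simp), one_mul]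
      _ ≤ _ := by gcongr
  calc (volume (Metric.closedBall x (t : ℝ)))⁻¹ * ∫⁻ y in Metric.closedBall x (t : ℝ), ‖f y‖ₑ
      ≤ (2 ^ d * (volume (Metric.closedBall x (q : ℝ)))⁻¹) *
        ∫⁻ y in Metric.closedBall x (q : ℝ), ‖f y‖ₑ := by
        gcongr
    _ ≤ _ := by
        rw [mul_assoc]
        gcongr
        exact le_iSup (fun q : {q : ℚ // 0 < q} => (volume (Metric.closedBall x (q : ℚ)))⁻¹ *
          ∫⁻ y in Metric.closedBall x (q : ℚ), ‖f y‖ₑ) ⟨q, hq⟩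

theorem lavg_mul_lavg_rpow {d : ℕ} {p : ℝ} (hp : 1 < p) (u v : (Fin d → ℝ) → ℝ)
    (I : Set (Fin d → ℝ)) :
    lavg d u I * lavg d v I ^ (p - 1) = (volume I ^ p)⁻¹ *
      ((∫⁻ y in I, ENNReal.ofReal (u y)) * (∫⁻ y in I, ENNReal.ofReal (v y)) ^ (p - 1)) := by
  have h1 : (volume I ^ p)⁻¹ = (volume I)⁻¹ * (volume I)⁻¹ ^ (p - 1) := by
    rw [← ENNReal.inv_rpow]
    conv_lhs => rw [show p = 1 + (p - 1) by ring, ENNReal.rpow_add_of_nonneg _ _ zero_le_one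
      (by linarith), ENNReal.rpow_one]
  rw [lavg, lavg, ENNReal.mul_rpow_of_nonneg _ _ (by linarith), h1]
  ring

theorem setLIntegral_closedBall_mul_rpow_le {d : ℕ} {p : ℝ} (hp : 1 < p)
    {w : (Fin d → ℝ) → ℝ} (hw : ∀ᵐ x : Fin d → ℝ, 0 < w x) (x : Fin d → ℝ) {r : ℝ} (hr : 0 < r) :
    (∫⁻ y in Metric.closedBall x r, ENNReal.ofReal (w y)) *
      (∫⁻ y in Metric.closedBall x r, ENNReal.ofReal (w y) ^ (-(p - 1)⁻¹)) ^ (p - 1) ≤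
    ApChar d p w * (2 ^ d) ^ p * volume (Metric.closedBall x r) ^ p := by
  set Q := cube d (fun i => x i - r) (4 * r) with hQ
  have hsub : Metric.closedBall x r ⊆ Q := closedBall_subset_cube x hr
  have hvol : volume Q = 2 ^ d * volume (Metric.closedBall x r) := by
    rw [hQ, volume_cube, Real.volume_pi_closedBall _ hr.le, Fintype.card_fin,
      show 4 * r = 2 * (2 * r) by ring, ENNReal.ofReal_mul (by norm_num), mul_pow,
      ENNReal.ofReal_pow (by positivity), ENNReal.ofReal_ofNat]
  have hQ0 : volume Q ≠ 0 := by
    rw [hQ, volume_cube]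
    exact pow_ne_zero _ (by simpa using hr)
  have hQtop : volume Q ≠ ⊤ := by
    rw [hQ, volume_cube]
    finiteness
  have hA : lavg d w Q * lavg d (fun y => w y ^ (-1 / (p - 1))) Q ^ (p - 1) ≤ ApChar d p w :=
    le_iSup₂_of_le (fun i => x i - r) ⟨4 * r, by simpa using hr⟩ le_rfl
  rw [lavg_mul_lavg_rpow hp] at hA
  have hσ : ∫⁻ y in Metric.closedBall x r, ENNReal.ofReal (w y) ^ (-(p - 1)⁻¹) ≤
      ∫⁻ y in Q, ENNReal.ofReal (w y ^ (-1 / (p - 1))) := by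
    refine (lintegral_mono_set hsub).trans (lintegral_mono_ae (ae_restrict_of_ae ?_))
    filter_upwards [hw] with y hy
    rw [ENNReal.ofReal_rpow_of_pos hy, neg_div, one_div]
  calc _ ≤ (∫⁻ y in Q, ENNReal.ofReal (w y)) *
        (∫⁻ y in Q, ENNReal.ofReal (w y ^ (-1 / (p - 1)))) ^ (p - 1) := by
        gcongr
    _ = volume Q ^ p * ((volume Q ^ p)⁻¹ * ((∫⁻ y in Q, ENNReal.ofReal (w y)) *
        (∫⁻ y in Q, ENNReal.ofReal (w y ^ (-1 / (p - 1)))) ^ (p - 1))) := by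
        rw [← mul_assoc, ENNReal.mul_inv_cancel, one_mul]
        · exact (ENNReal.rpow_pos (pos_iff_ne_zero.2 hQ0) hQtop).ne'
        · exact ENNReal.rpow_ne_top_of_nonneg (by linarith) hQtop
    _ ≤ volume Q ^ p * ApChar d p w := by gcongr
    _ = _ := by
        rw [hvol, ENNReal.mul_rpow_of_nonneg _ _ (by linarith)]
        ring

theorem exists_majorant_maximalFn_of_ApChar_lt_top {d : ℕ} {p : ℝ} (hp : 1 < p)
    {w : (Fin d → ℝ) → ℝ} (hw : IsWeight d w) (hA : ApChar d p w < ⊤) :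
    ∃ C : ℝ, 0 < C ∧ ∀ f : (Fin d → ℝ) → ℝ, Measurable f →
      ∃ M : (Fin d → ℝ) → ℝ≥0∞, Measurable M ∧ (∀ x, maximalFn d f x ≤ M x) ∧
        ∫⁻ x, M x ^ p * ENNReal.ofReal (w x) ≤
          ENNReal.ofReal (C ^ p) * ∫⁻ x, ‖f x‖ₑ ^ p * ENNReal.ofReal (w x) := by
  obtain ⟨hwm, hwl, hw0⟩ := hw
  have hp0 : 0 < p := by linarith
  have hvB : ∀ (x : Fin d → ℝ) r, ∫⁻ y in Metric.closedBall x r, ENNReal.ofReal (w y) ≠ ⊤ := by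
    intro x r
    have := (hwl.integrableOn_isCompact (isCompact_closedBall x r)).lintegral_lt_top
    exact this.ne
  obtain ⟨D, hD, h⟩ := exists_lintegral_centeredMaximal_volume_rpow_le hp hwm.ennreal_ofReal
    (by filter_upwards [hw0] with x hx; exact ⟨by simpa using hx, by simp⟩) hvB
    (A := (ApChar d p w + 1) * (2 ^ d) ^ p)
    (mul_ne_zero (by simp) (ENNReal.rpow_pos (by positivity) (by simp)).ne')
    (ENNReal.mul_ne_top (by simpa using hA.ne)
      (ENNReal.rpow_ne_top_of_nonneg hp0.le (by simp)))
    (fun x r hr => (setLIntegral_closedBall_mul_rpow_le hp hw0 x hr).trans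
      (by gcongr; exact le_self_add))
  have hE : (2 ^ d) ^ p * D ≠ ⊤ := ENNReal.mul_ne_top
    (ENNReal.rpow_ne_top_of_nonneg hp0.le (by simp)) hD
  refine ⟨(((2 ^ d) ^ p * D).toReal + 1) ^ p⁻¹, by positivity, fun f hf =>
    ⟨fun x => 2 ^ d * centeredMaximal volume (fun y => ‖f y‖ₑ) x,
      (measurable_centeredMaximal _ hf.enorm).const_mul _, maximalFn_le_centeredMaximal d f, ?_⟩⟩
  rw [← Real.rpow_mul (by positivity), inv_mul_cancel₀ hp0.ne', Real.rpow_one]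
  calc ∫⁻ x, (2 ^ d * centeredMaximal volume (fun y => ‖f y‖ₑ) x) ^ p * ENNReal.ofReal (w x)
      = (2 ^ d) ^ p *
        ∫⁻ x, centeredMaximal volume (fun y => ‖f y‖ₑ) x ^ p * ENNReal.ofReal (w x) := by
        rw [← lintegral_const_mul' _ _ (ENNReal.rpow_ne_top_of_nonneg hp0.le (by simp))]
        simp_rw [ENNReal.mul_rpow_of_nonneg _ _ hp0.le, mul_assoc]
    _ ≤ ((2 ^ d) ^ p * D) * ∫⁻ x, ‖f x‖ₑ ^ p * ENNReal.ofReal (w x) := by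
        rw [mul_assoc]
        gcongr
        exact h _ hf.enorm
    _ ≤ _ := by
        gcongr
        rw [ENNReal.le_ofReal_iff_toReal_le hE (by positivity)]
        linarith

/-- Testing a weighted weak-type bound on truncations of `w ^ (-1 / (p - 1))` over cubes gives
the `A_p` condition. -/
theorem ApChar_lt_top_of_weak_type {d : ℕ} {p : ℝ} (hp : 1 < p)
    {w : (Fin d → ℝ) → ℝ} (hw : IsWeight d w) {C : ℝ≥0∞} (hC : C ≠ ⊤)
    (h : ∀ f : (Fin d → ℝ) → ℝ, Measurable f → ∀ l : ℝ, 0 < l → ∀ I : Set (Fin d → ℝ),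
      MeasurableSet I → (∀ x ∈ I, ENNReal.ofReal l < maximalFn d f x) →
      ENNReal.ofReal (l ^ p) * ∫⁻ x in I, ENNReal.ofReal (w x) ≤
        C * ∫⁻ x, ‖f x‖ₑ ^ p * ENNReal.ofReal (w x)) :
    ApChar d p w < ⊤ := by
  obtain ⟨hwm, hwl, hw0⟩ := hw
  have hp0 : 0 < p := by linarith
  have hp1 : 0 < p - 1 := by linarith
  have hK : C * (2 * 2 ^ d) ^ p ≠ ⊤ := ENNReal.mul_ne_top hC
    (ENNReal.rpow_ne_top_of_nonneg hp0.le (by finiteness))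
  refine (iSup₂_le fun x => ?_ : ApChar d p w ≤ C * (2 * 2 ^ d) ^ p).trans_lt hK.lt_top
  rintro ⟨r, hr : 0 < r⟩
  set I := cube d x r with hI
  have hIm : MeasurableSet I := measurableSet_cube d x r
  have hI0 : volume I ≠ 0 := by
    rw [hI, volume_cube]
    exact pow_ne_zero _ (by simpa using hr)
  have hItop : volume I ≠ ⊤ := by
    rw [hI, volume_cube]
    finiteness
  have hV0 : volume I ^ p ≠ 0 := (ENNReal.rpow_pos (pos_iff_ne_zero.2 hI0) hItop).ne'
  have hVtop : volume I ^ p ≠ ⊤ := ENNReal.rpow_ne_top_of_nonneg hp0.le hItop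
  have hvI : ∫⁻ y in I, ENNReal.ofReal (w y) ≠ ⊤ := by
    have hx : x ∈ cube d x r := fun i _ => ⟨le_rfl, by linarith⟩
    refine ((lintegral_mono_set (cube_subset_closedBall hr.le hx)).trans_lt ?_).ne
    exact (hwl.integrableOn_isCompact (isCompact_closedBall x r)).lintegral_lt_top
  rw [lavg_mul_lavg_rpow hp]
  set σ : (Fin d → ℝ) → ℝ := fun y => w y ^ (-1 / (p - 1)) with hσ
  have hσm : Measurable σ := hwm.pow_const _
  let T : ℕ → Set (Fin d → ℝ) := fun n => {y | 0 < w y ∧ σ y ≤ n} ∩ I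
  have hTm : ∀ n, MeasurableSet (T n) := fun n =>
    ((measurableSet_lt measurable_const hwm).inter (measurableSet_le hσm measurable_const)).inter
      hIm
  set S : ℕ → ℝ≥0∞ := fun n => ∫⁻ y in T n, ENNReal.ofReal (σ y) with hS
  have hStop : ∀ n, S n ≠ ⊤ := by
    intro n
    refine ((setLIntegral_mono' (g := fun _ => (n : ℝ≥0∞)) (hTm n) fun y hy => ?_).trans_lt ?_).ne
    · exact ENNReal.ofReal_le_of_le_toReal (by simpa using hy.1.2)
    · rw [setLIntegral_const]
      exact ENNReal.mul_lt_top (by simp)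
        ((measure_mono inter_subset_right).trans_lt hItop.lt_top)
  have hbound : ∀ n, (∫⁻ y in I, ENNReal.ofReal (w y)) * S n ^ (p - 1) ≤
      C * (2 * 2 ^ d) ^ p * volume I ^ p := by
    intro n
    rcases eq_or_ne (S n) 0 with h0 | h0
    · simp [h0, ENNReal.zero_rpow_of_pos hp1]
    set f : (Fin d → ℝ) → ℝ := (T n).indicator σ with hf
    have hfm : Measurable f := hσm.indicator (hTm n)
    have hfσ : ∀ y, ‖f y‖ₑ = (T n).indicator (fun y => ENNReal.ofReal (σ y)) y := by
      intro y
      by_cases hy : y ∈ T n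
      · rw [hf, indicator_of_mem hy, indicator_of_mem hy, Real.enorm_eq_ofReal]
        exact Real.rpow_nonneg hy.1.1.le _
      · rw [hf, indicator_of_notMem hy, indicator_of_notMem hy, enorm_zero]
    have hfp : ∫⁻ y, ‖f y‖ₑ ^ p * ENNReal.ofReal (w y) = S n := by
      simp only [hS]
      rw [← lintegral_indicator (hTm n)]
      refine lintegral_congr fun y => ?_
      rw [hfσ]
      by_cases hy : y ∈ T n
      · have hwy : 0 < w y := hy.1.1
        rw [indicator_of_mem hy, hσ,
          ENNReal.ofReal_rpow_of_pos (Real.rpow_pos_of_pos hwy _), ← Real.rpow_mul hwy.le,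
          ← ENNReal.ofReal_mul (by positivity), ← Real.rpow_add_one hwy.ne']
        congr 2
        field_simp
        ring
      · rw [indicator_of_notMem hy, ENNReal.zero_rpow_of_pos hp0, zero_mul]
    set V : ℝ≥0∞ := 2 ^ d * volume I with hV
    have hVol0 : V ≠ 0 := mul_ne_zero (by simp) hI0
    have hVolt : V ≠ ⊤ := ENNReal.mul_ne_top (by simp) hItop
    have havg : ∀ y ∈ I, V⁻¹ * S n ≤ maximalFn d f y := by
      intro y hy
      rw [maximalFn_eq_iSup_closedBall]
      refine le_trans ?_ (le_iSup _ (⟨r, hr⟩ : Set.Ioi (0 : ℝ)))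
      have hvol : volume (Metric.closedBall y r) = V := by
        rw [hV, hI, volume_cube, Real.volume_pi_closedBall _ hr.le, Fintype.card_fin, mul_pow,
          ENNReal.ofReal_mul (by positivity), ENNReal.ofReal_pow (by norm_num),
          ENNReal.ofReal_pow hr.le, ENNReal.ofReal_ofNat]
      simp only [hvol]
      gcongr
      simp_rw [hfσ]
      rw [lintegral_indicator (hTm n), Measure.restrict_restrict (hTm n), inter_eq_left.2]
      exact inter_subset_right.trans (cube_subset_closedBall hr.le hy)
    set b : ℝ≥0∞ := 2⁻¹ * (V⁻¹ * S n) with hb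
    have hc0 : V⁻¹ * S n ≠ 0 := mul_ne_zero (by simpa using hVolt) h0
    have hct : V⁻¹ * S n ≠ ⊤ := ENNReal.mul_ne_top (by simpa using hVol0) (hStop n)
    have hblt : b < V⁻¹ * S n := by
      rw [hb, mul_comm, ← div_eq_mul_inv]
      exact ENNReal.half_lt_self hc0 hct
    have hb0 : b ≠ 0 := mul_ne_zero (by simp) hc0
    have hbt : b ≠ ⊤ := hblt.ne_top
    have hbpos : 0 < b.toReal := ENNReal.toReal_pos hb0 hbt
    have key := h f hfm b.toReal hbpos I hIm fun y hy => by
      rw [ENNReal.ofReal_toReal hbt]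
      exact hblt.trans_le (havg y hy)
    rw [hfp, ← ENNReal.ofReal_rpow_of_pos hbpos, ENNReal.ofReal_toReal hbt, hb] at key
    have hbp : b ^ p = ((2 * V) ^ p)⁻¹ * (S n * S n ^ (p - 1)) := by
      have hSp : S n * S n ^ (p - 1) = S n ^ p := by
        conv_rhs => rw [show p = 1 + (p - 1) by ring,
          ENNReal.rpow_add_of_nonneg _ _ zero_le_one hp1.le, ENNReal.rpow_one]
      rw [hSp, ← ENNReal.inv_rpow, ← ENNReal.mul_rpow_of_nonneg _ _ hp0.le,
        ENNReal.mul_inv (by simp) (by simp), mul_assoc]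
    rw [← hb, hbp] at key
    have hW0 : (2 * V) ^ p ≠ 0 :=
      (ENNReal.rpow_pos (pos_iff_ne_zero.2 (mul_ne_zero (by simp) hVol0))
        (ENNReal.mul_ne_top (by simp) hVolt)).ne'
    have hWt : (2 * V) ^ p ≠ ⊤ :=
      ENNReal.rpow_ne_top_of_nonneg hp0.le (ENNReal.mul_ne_top (by simp) hVolt)
    calc (∫⁻ y in I, ENNReal.ofReal (w y)) * S n ^ (p - 1)
        = ((2 * V) ^ p * ((2 * V) ^ p)⁻¹) * ((S n)⁻¹ * S n) *
          ((∫⁻ y in I, ENNReal.ofReal (w y)) * S n ^ (p - 1)) := by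
          rw [ENNReal.mul_inv_cancel hW0 hWt, ENNReal.inv_mul_cancel h0 (hStop n), one_mul, one_mul]
      _ = (2 * V) ^ p * (S n)⁻¹ * (((2 * V) ^ p)⁻¹ * (S n * S n ^ (p - 1)) *
          ∫⁻ y in I, ENNReal.ofReal (w y)) := by ring
      _ ≤ (2 * V) ^ p * (S n)⁻¹ * (C * S n) := by gcongr
      _ = (2 * V) ^ p * C * ((S n)⁻¹ * S n) := by ring
      _ = _ := by
          rw [ENNReal.inv_mul_cancel h0 (hStop n), hV, ← mul_assoc 2,
            ENNReal.mul_rpow_of_nonneg _ _ hp0.le]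
          ring
  have hlim : Filter.Tendsto S Filter.atTop (nhds (∫⁻ y in I, ENNReal.ofReal (σ y))) := by
    have hSI : S = fun n : ℕ => ∫⁻ y in I,
        {y | 0 < w y ∧ σ y ≤ n}.indicator (fun y => ENNReal.ofReal (σ y)) y := by
      funext n
      have hm : MeasurableSet {y | 0 < w y ∧ σ y ≤ n} :=
        (measurableSet_lt measurable_const hwm).inter (measurableSet_le hσm measurable_const)
      rw [lintegral_indicator hm, Measure.restrict_restrict hm]
    rw [hSI]
    refine lintegral_tendsto_of_tendsto_of_monotone (fun n => ?_) ?_ ?_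
    · exact (hσm.ennreal_ofReal.indicator ((measurableSet_lt measurable_const hwm).inter
        (measurableSet_le hσm measurable_const))).aemeasurable
    · refine Filter.Eventually.of_forall fun y m n hmn => ?_
      refine indicator_le_indicator_of_subset ?_ (fun _ => zero_le) y
      rintro z ⟨h1, h2⟩
      exact ⟨h1, h2.trans (by exact_mod_cast hmn)⟩
    · refine ae_restrict_of_ae ?_
      filter_upwards [hw0] with y hy
      obtain ⟨N, hN⟩ := exists_nat_ge (σ y)
      refine tendsto_const_nhds.congr' ?_
      filter_upwards [Filter.eventually_ge_atTop N] with n hn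
      have hmem : y ∈ {y | 0 < w y ∧ σ y ≤ n} := ⟨hy, hN.trans (by exact_mod_cast hn)⟩
      rw [indicator_of_mem hmem]
  have hfinal := le_of_tendsto' (ENNReal.Tendsto.const_mul
    ((ENNReal.continuous_rpow_const.tendsto _).comp hlim) (Or.inr hvI)) hbound
  calc _ ≤ (volume I ^ p)⁻¹ * (C * (2 * 2 ^ d) ^ p * volume I ^ p) := by gcongr
    _ = C * (2 * 2 ^ d) ^ p * ((volume I ^ p)⁻¹ * volume I ^ p) := by ring
    _ = _ := by rw [ENNReal.inv_mul_cancel hV0 hVtop, mul_one]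

/-- **Muckenhoupt's maximal function theorem.** For `1 < p < ∞` and a weight `w` on `ℝ^d`,
the following are equivalent: (1) `w ∈ A_p`; (2) the Hardy–Littlewood maximal operator `M` is
bounded from `L^p(w)` to weak-`L^p(w)`; (3) `M` is bounded from `L^p(w)` to `L^p(w)`. -/
theorem muckenhoupt_maximal_characterization
    (d : ℕ) (p : ℝ) (hp : 1 < p)
    (w : (Fin d → ℝ) → ℝ) (hw : IsWeight d w) :
    (ApChar d p w < ⊤ ↔
      ∃ C : ℝ, 0 < C ∧ ∀ f : (Fin d → ℝ) → ℝ, Measurable f → ∀ lam : ℝ, 0 < lam →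
        ENNReal.ofReal (lam ^ p) *
            (∫⁻ x in {x | ENNReal.ofReal lam < maximalFn d f x}, ENNReal.ofReal (w x)) ≤
          ENNReal.ofReal (C ^ p) * ∫⁻ x, (‖f x‖₊ : ℝ≥0∞) ^ p * ENNReal.ofReal (w x))
    ∧
    (ApChar d p w < ⊤ ↔
      ∃ C : ℝ, 0 < C ∧ ∀ f : (Fin d → ℝ) → ℝ, Measurable f →
        ∫⁻ x, (maximalFn d f x) ^ p * ENNReal.ofReal (w x) ≤
          ENNReal.ofReal (C ^ p) * ∫⁻ x, (‖f x‖₊ : ℝ≥0∞) ^ p * ENNReal.ofReal (w x)) := by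
  have hp0 : 0 < p := by linarith
  refine ⟨⟨fun hA => ?_, ?_⟩, ⟨fun hA => ?_, ?_⟩⟩
  · obtain ⟨C, hC, h⟩ := exists_majorant_maximalFn_of_ApChar_lt_top hp hw hA
    refine ⟨C, hC, fun f hf lam hlam => ?_⟩
    obtain ⟨M, hM, hfM, hle⟩ := h f hf
    have hm : MeasurableSet {x | ENNReal.ofReal lam < M x} := measurableSet_lt measurable_const hM
    refine le_trans ?_ hle
    calc _ ≤ ENNReal.ofReal (lam ^ p) *
          ∫⁻ x in {x | ENNReal.ofReal lam < M x}, ENNReal.ofReal (w x) := by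
          refine mul_le_mul_right (lintegral_mono_set fun x hx => ?_) _
          exact lt_of_lt_of_le hx (hfM x)
      _ = ∫⁻ x in {x | ENNReal.ofReal lam < M x},
          ENNReal.ofReal (lam ^ p) * ENNReal.ofReal (w x) :=
          (lintegral_const_mul _ hw.1.ennreal_ofReal).symm
      _ ≤ ∫⁻ x in {x | ENNReal.ofReal lam < M x}, M x ^ p * ENNReal.ofReal (w x) := by
          refine setLIntegral_mono' hm fun x hx => ?_
          rw [← ENNReal.ofReal_rpow_of_pos hlam]
          gcongr
          exact le_of_lt hx
      _ ≤ _ := setLIntegral_le_lintegral _ _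
  · rintro ⟨C, _, h⟩
    refine ApChar_lt_top_of_weak_type hp hw (C := ENNReal.ofReal (C ^ p)) (by simp) ?_
    intro f hf l hl I _ hI
    exact le_trans (by gcongr; exact hI) (h f hf l hl)
  · obtain ⟨C, hC, h⟩ := exists_majorant_maximalFn_of_ApChar_lt_top hp hw hA
    refine ⟨C, hC, fun f hf => ?_⟩
    obtain ⟨M, hM, hfM, hle⟩ := h f hf
    refine le_trans (lintegral_mono fun x => ?_) hle
    gcongr
    exact hfM x
  · rintro ⟨C, _, h⟩
    refine ApChar_lt_top_of_weak_type hp hw (C := ENNReal.ofReal (C ^ p)) (by simp) ?_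
    intro f hf l hl I hIm hI
    refine le_trans ?_ (h f hf)
    rw [← lintegral_const_mul _ hw.1.ennreal_ofReal]
    refine (setLIntegral_mono' hIm fun x hx => ?_).trans (setLIntegral_le_lintegral _ _)
    rw [← ENNReal.ofReal_rpow_of_pos hl]
    gcongr
    exact (hI x hx).le
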